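/- arXiv:2406.05609 — 3 statements merged into one kernel-verified Lean document; each statement's English description precedes it below -/
import Mathlib

section
/- In the Setup, the degree of u* satisfies |A| = t(G) + 1; that is, the neighborhood of u* has exactly one more vertex than the number of triangles of G. -/
open Matrix

/-- The spectral radius of a finite simple graph: the largest eigenvalue of its
adjacency matrix (as a real symmetric matrix), expressed as the supremum of the
set of eigenvalues of the associated linear endomorphism. -/
noncomputable def specRad {V : Type*} [Fintype V] (G : SimpleGraph V) : ℝ :=
  letI := Classical.decEq V
  letI := Classical.decRel G.Adj
  sSup {μ : ℝ | Module.End.HasEigenvalue (Matrix.toLin' (SimpleGraph.adjMatrix ℝ G)) μ}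

/-- The number of triangles (3-cliques) of a finite simple graph. -/
noncomputable def triangleCount {V : Type*} [Fintype V] (G : SimpleGraph V) : ℕ :=
  letI := Classical.decEq V
  letI := Classical.decRel G.Adj
  (G.cliqueFinset 3).card

/-- The graph on `Fin n` obtained from the complete bipartite graph with parts
`{0, …, a-1}` and `{a, …, n-1}` by adding the extra edge `{0, 1}` inside the
first part. -/
def KbipPlus (n a : ℕ) : SimpleGraph (Fin n) :=
  SimpleGraph.fromRel (fun u v => ((u : ℕ) < a ∧ a ≤ (v : ℕ)) ∨ ((u : ℕ) = 0 ∧ (v : ℕ) = 1))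

/-- `K⁺_{⌈n/2⌉,⌊n/2⌋}`: the complete bipartite graph with parts of sizes `⌈n/2⌉`
and `⌊n/2⌋` together with one extra edge inside the part of size `⌈n/2⌉`
(added between vertices `0` and `1`). -/
def Kplus (n : ℕ) : SimpleGraph (Fin n) := KbipPlus n ((n + 1) / 2)

/-- `K^{+|}`: the graph on `Fin n` obtained from the complete bipartite graph with
parts `{0, …, a-1}` and `{a, …, n-1}` by adding the edge `e₁ = {0, 1}` inside the
first part and deleting the cross edge `e₂ = {0, a}`, which shares the endpoint `0`
with `e₁`. -/
def KbipPlusMinus (n a : ℕ) : SimpleGraph (Fin n) :=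
  SimpleGraph.fromRel (fun u v =>
    (((u : ℕ) < a ∧ a ≤ (v : ℕ)) ∧ ¬((u : ℕ) = 0 ∧ (v : ℕ) = a)) ∨
      ((u : ℕ) = 0 ∧ (v : ℕ) = 1))


section Combinatorics

variable {V : Type*} [Fintype V] [DecidableEq V]

theorem sq_div_four_succ (n : ℕ) : (n + 1) ^ 2 / 4 = n ^ 2 / 4 + (n + 1) / 2 := by
  obtain ⟨k, rfl | rfl⟩ := n.even_or_odd'
  · have h₁ : (2 * k + 1) ^ 2 = 4 * (k ^ 2 + k) + 1 := by ring
    have h₂ : (2 * k) ^ 2 = 4 * k ^ 2 := by ring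
    omega
  · have h₁ : (2 * k + 1 + 1) ^ 2 = 4 * (k ^ 2 + 2 * k + 1) := by ring
    have h₂ : (2 * k + 1) ^ 2 = 4 * (k ^ 2 + k) + 1 := by ring
    omega

theorem degree_deleteIncidenceSet_of_adj {G : SimpleGraph V} [DecidableRel G.Adj] {u v : V}
    (h : G.Adj u v) : (G.deleteIncidenceSet v).degree u + 1 = G.degree u := by
  have h₁ : (G.deleteIncidenceSet v).neighborFinset u = (G.neighborFinset u).erase v := by
    ext w
    simp only [SimpleGraph.mem_neighborFinset, SimpleGraph.deleteIncidenceSet_adj,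
      Finset.mem_erase]
    have := h.ne
    tauto
  have h₂ : v ∈ G.neighborFinset u := by simpa using h
  rw [← SimpleGraph.card_neighborFinset_eq_degree, h₁, Finset.card_erase_add_one h₂,
    SimpleGraph.card_neighborFinset_eq_degree]

theorem degree_deleteIncidenceSet_of_not_adj {G : SimpleGraph V} [DecidableRel G.Adj] {u v : V}
    (hne : u ≠ v) (h : ¬ G.Adj u v) : (G.deleteIncidenceSet v).degree u = G.degree u := by
  simp only [← SimpleGraph.card_neighborFinset_eq_degree]
  congr 1
  ext w
  simp only [SimpleGraph.mem_neighborFinset, SimpleGraph.deleteIncidenceSet_adj]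
  grind

theorem degree_deleteEdges_of_ne {G : SimpleGraph V} [DecidableRel G.Adj] {u p q : V}
    (hp : u ≠ p) (hq : u ≠ q) : (G.deleteEdges {s(p, q)}).degree u = G.degree u := by
  simp only [← SimpleGraph.card_neighborFinset_eq_degree]
  congr 1
  ext w
  simp only [SimpleGraph.mem_neighborFinset, SimpleGraph.deleteEdges_adj, Set.mem_singleton_iff,
    Sym2.eq_iff]
  grind

theorem card_edgeFinset_deleteEdges_singleton {G : SimpleGraph V} [DecidableRel G.Adj] {p q : V}
    (h : G.Adj p q) :
    (G.deleteEdges {s(p, q)}).edgeFinset.card + 1 = G.edgeFinset.card := by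
  have h₁ : (G.deleteEdges {s(p, q)}).edgeFinset = G.edgeFinset.erase s(p, q) := by
    ext e
    simp [and_comm]
  rw [h₁, Finset.card_erase_add_one (by simpa using h)]

theorem card_edgeFinset_deleteIncidenceSet_add_degree (G : SimpleGraph V) [DecidableRel G.Adj]
    (v : V) : (G.deleteIncidenceSet v).edgeFinset.card + G.degree v = G.edgeFinset.card := by
  rw [SimpleGraph.card_edgeFinset_deleteIncidenceSet]
  exact Nat.sub_add_cancel (G.degree_le_card_edgeFinset v)

theorem card_cliqueFinset_le_of_le {G H : SimpleGraph V} [DecidableRel G.Adj] [DecidableRel H.Adj]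
    (h : H ≤ G) : (H.cliqueFinset 3).card ≤ (G.cliqueFinset 3).card :=
  Finset.card_le_card (SimpleGraph.cliqueFinset_mono _ h)

theorem card_cliqueFinset_lt_of_le {G H : SimpleGraph V} [DecidableRel G.Adj] [DecidableRel H.Adj]
    (h : H ≤ G) {p q r : V} (hpq : G.Adj p q) (hpr : G.Adj p r) (hqr : G.Adj q r)
    (hH : ¬ H.Adj p q) : (H.cliqueFinset 3).card < (G.cliqueFinset 3).card := by
  refine Finset.card_lt_card ⟨SimpleGraph.cliqueFinset_mono _ h, fun hsub => hH ?_⟩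
  have h₁ : ({p, q, r} : Finset V) ∈ G.cliqueFinset 3 := by
    rw [SimpleGraph.mem_cliqueFinset_iff, SimpleGraph.is3Clique_triple_iff]
    exact ⟨hpq, hpr, hqr⟩
  have h₂ := hsub h₁
  rw [SimpleGraph.mem_cliqueFinset_iff, SimpleGraph.is3Clique_triple_iff] at h₂
  exact h₂.1

/-- Adjacent vertices without a common neighbour have disjoint neighbourhoods in the support. -/
theorem degree_add_degree_le {G : SimpleGraph V} [DecidableRel G.Adj] {S : Finset V}
    (hS : ∀ p q, G.Adj p q → p ∈ S) {p q : V} (h : ∀ r, G.Adj p r → ¬ G.Adj q r) :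
    G.degree p + G.degree q ≤ S.card := by
  simp only [← SimpleGraph.card_neighborFinset_eq_degree]
  rw [← Finset.card_union_of_disjoint]
  · refine Finset.card_le_card fun w hw => ?_
    simp only [Finset.mem_union, SimpleGraph.mem_neighborFinset] at hw
    rcases hw with hw | hw <;> exact hS _ _ hw.symm
  · rw [Finset.disjoint_left]
    intro w hp hq
    simp only [SimpleGraph.mem_neighborFinset] at hp hq
    exact h w hp hq

theorem card_edgeFinset_le_of_triangle_free (n : ℕ) (S : Finset V) (hn : S.card = n)
    (G : SimpleGraph V) [DecidableRel G.Adj] (hS : ∀ p q, G.Adj p q → p ∈ S)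
    (hG : ∀ p q r, G.Adj p q → G.Adj p r → ¬ G.Adj q r) :
    G.edgeFinset.card ≤ n ^ 2 / 4 := by
  induction n generalizing S G with
  | zero =>
    rw [Finset.card_eq_zero] at hn
    subst hn
    have : G.edgeFinset = ∅ := by
      ext e
      induction e with | _ p q => simpa using fun h => by simpa using hS p q h
    simp [this]
  | succ n ih =>
    by_cases hE : ∃ p q, G.Adj p q
    · obtain ⟨p, q, hpq⟩ := hE
      have hsum := degree_add_degree_le hS (p := p) (q := q)
        fun r hpr hqr => hG p q r hpq hpr hqr
      obtain ⟨v, hv, hd⟩ : ∃ v ∈ S, G.degree v ≤ (n + 1) / 2 := by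
        by_cases h : G.degree p ≤ (n + 1) / 2
        · exact ⟨p, hS _ _ hpq, h⟩
        · exact ⟨q, hS _ _ hpq.symm, by omega⟩
      have h₁ := ih (S.erase v) (by rw [Finset.card_erase_of_mem hv, hn]; rfl)
        (G.deleteIncidenceSet v)
        (fun a b h => by
          rw [SimpleGraph.deleteIncidenceSet_adj] at h
          exact Finset.mem_erase.2 ⟨h.2.1, hS _ _ h.1⟩)
        (fun a b c hab hac hbc => hG a b c (SimpleGraph.deleteIncidenceSet_le _ _ hab)
          (SimpleGraph.deleteIncidenceSet_le _ _ hac) (SimpleGraph.deleteIncidenceSet_le _ _ hbc))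
      have h₂ := card_edgeFinset_deleteIncidenceSet_add_degree G v
      have h₃ := sq_div_four_succ n
      omega
    · have : G.edgeFinset = ∅ := by
        ext e
        induction e with | _ p q => simpa using fun h => hE ⟨p, q, h⟩
      simp [this]

/-- A strengthening of the Erdős–Rademacher theorem: a graph with more than `n ^ 2 / 4` edges has
at least `Δ - 1` triangles. -/
theorem card_edgeFinset_le_of_card_cliqueFinset_add_two_le (k : ℕ) (S : Finset V)
    (G : SimpleGraph V) [DecidableRel G.Adj] (hk : S.card + G.edgeFinset.card = k)
    (hS : ∀ p q, G.Adj p q → p ∈ S) (u : V) (hu : (G.cliqueFinset 3).card + 2 ≤ G.degree u) :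
    G.edgeFinset.card ≤ S.card ^ 2 / 4 := by
  induction k using Nat.strong_induction_on generalizing S G with
  | _ k ih =>
  by_contra! hm
  obtain ⟨n, hn⟩ : ∃ n, S.card = n + 1 := by
    refine Nat.exists_eq_succ_of_ne_zero fun h => ?_
    rw [Finset.card_eq_zero] at h
    subst h
    obtain ⟨w, hw⟩ : (G.neighborFinset u).Nonempty := by
      rw [← Finset.card_pos, SimpleGraph.card_neighborFinset_eq_degree]; omega
    rw [SimpleGraph.mem_neighborFinset] at hw
    simpa using hS _ _ hw
  have hf := sq_div_four_succ n
  rw [hn] at hm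
  obtain ⟨p, q, r, hpq, hpr, hqr⟩ : ∃ p q r, G.Adj p q ∧ G.Adj p r ∧ G.Adj q r := by
    by_contra! h
    have := card_edgeFinset_le_of_triangle_free (n + 1) S hn G hS h
    omega
  -- Some edge of a triangle avoids `u`.
  obtain ⟨p, q, r, hpq, hpr, hqr, hup, huq⟩ : ∃ p q r, G.Adj p q ∧ G.Adj p r ∧ G.Adj q r ∧
      u ≠ p ∧ u ≠ q := by
    by_cases hup : u = p
    · refine ⟨q, r, p, hqr, hpq.symm, hpr.symm, ?_, ?_⟩ <;> rw [hup]
      exacts [hpq.ne, hpr.ne]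
    by_cases huq : u = q
    · refine ⟨p, r, q, hpr, hpq, hqr.symm, hup, ?_⟩
      rw [huq]; exact hqr.ne
    exact ⟨p, q, r, hpq, hpr, hqr, hup, huq⟩
  have hdelS : ∀ (H : SimpleGraph V) (v : V), H ≤ G → ∀ a b, (H.deleteIncidenceSet v).Adj a b →
      a ∈ S.erase v := fun H v hH a b h => by
    rw [SimpleGraph.deleteIncidenceSet_adj] at h
    exact Finset.mem_erase.2 ⟨h.2.1, hS _ _ (hH h.1)⟩
  have hcard : ∀ v ∈ S, (S.erase v).card = n := fun v hv => by
    rw [Finset.card_erase_of_mem hv, hn]; rfl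
  have hedge := card_edgeFinset_deleteEdges_singleton hpq
  have htri := card_cliqueFinset_lt_of_le (G.deleteEdges_le {s(p, q)}) hpq hpr hqr (by simp)
  have hdeg := degree_deleteEdges_of_ne (G := G) hup huq
  have hm' : G.edgeFinset.card = (n + 1) ^ 2 / 4 + 1 := by
    have := ih _ (by omega) S (G.deleteEdges {s(p, q)}) rfl
      (fun a b h => hS a b (G.deleteEdges_le _ h)) (by omega)
    rw [hn] at this
    omega
  have hlarge : ∀ v ∈ S, v ≠ u → (G.Adj u v → ∃ a b, G.Adj v a ∧ G.Adj v b ∧ G.Adj a b) →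
      (n + 1) / 2 < G.degree v := by
    intro v hv hvu htv
    by_contra! hd
    have h₁ := card_edgeFinset_deleteIncidenceSet_add_degree G v
    have h₂ := hcard v hv
    have h₃ := ih _ (by omega) (S.erase v) (G.deleteIncidenceSet v) rfl (hdelS G v le_rfl) (by
      by_cases huv : G.Adj u v
      · obtain ⟨a, b, hva, hvb, hab⟩ := htv huv
        have := card_cliqueFinset_lt_of_le (G.deleteIncidenceSet_le v) hva hvb hab
          (by simp [SimpleGraph.deleteIncidenceSet_adj])
        have := degree_deleteIncidenceSet_of_adj huv
        omega
      · have := card_cliqueFinset_le_of_le (G.deleteIncidenceSet_le v)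
        have := degree_deleteIncidenceSet_of_not_adj hvu.symm huv
        omega)
    rw [h₂] at h₃
    omega
  by_cases hA : ∃ a, G.Adj u a ∧ ∀ b c, G.Adj a b → G.Adj a c → ¬ G.Adj b c
  · obtain ⟨a, hua, ha⟩ := hA
    have haS := hS _ _ hua.symm
    have hap : a ≠ p := by rintro rfl; exact ha q r hpq hpr hqr
    have haq : a ≠ q := by rintro rfl; exact ha p r hpq.symm hqr hpr
    have hda : (n + 1) / 2 ≤ G.degree a := by
      by_contra! hd
      have h₁ := card_edgeFinset_deleteIncidenceSet_add_degree (G.deleteEdges {s(p, q)}) a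
      have h₂ := hcard a haS
      have h₃ := degree_deleteEdges_of_ne (G := G) hap haq
      have h₄ := degree_deleteIncidenceSet_of_adj (G := G.deleteEdges {s(p, q)}) (u := u) (v := a)
        (by simp [hua, hup, huq])
      have h₅ := card_cliqueFinset_le_of_le ((G.deleteEdges {s(p, q)}).deleteIncidenceSet_le a)
      have h₆ := ih _ (by omega) (S.erase a) ((G.deleteEdges {s(p, q)}).deleteIncidenceSet a) rfl
        (hdelS _ a (G.deleteEdges_le _)) (by omega)
      rw [h₂] at h₆
      omega
    have hnbr : ∀ w, G.Adj a w → w ≠ u → G.degree w + G.degree a ≤ n + 1 ∧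
        (n + 1) / 2 < G.degree w := by
      intro w haw hwu
      refine ⟨?_, hlarge w (hS _ _ haw.symm) hwu fun h => (ha u w hua.symm haw h).elim⟩
      rw [← hn]
      exact degree_add_degree_le hS fun r hwr har => ha w r haw har hwr
    have hdu : G.degree u + G.degree a ≤ n + 1 := by
      rw [← hn]
      exact degree_add_degree_le hS fun r hur har => ha u r hua.symm har hur
    obtain ⟨y, z, hyz, hay, haz⟩ : ∃ y z, G.Adj y z ∧ ¬ G.Adj a y ∧ ¬ G.Adj a z := by
      by_cases h : G.Adj a p
      · exact ⟨q, r, hqr, fun h' => ha p q h h' hpq, fun h' => ha p r h h' hpr⟩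
      by_cases h' : G.Adj a q
      · exact ⟨p, r, hpr, h, fun h'' => ha q r h' h'' hqr⟩
      exact ⟨p, q, hpq, h, h'⟩
    have hda2 : 2 ≤ G.degree a := by omega
    obtain ⟨w, hw⟩ : ((G.neighborFinset a).erase u).Nonempty := by
      rw [← Finset.card_pos, Finset.card_erase_of_mem (by simpa using hua.symm),
        SimpleGraph.card_neighborFinset_eq_degree]
      omega
    rw [Finset.mem_erase, SimpleGraph.mem_neighborFinset] at hw
    have hww := hnbr w hw.2 hw.1
    -- A neighbour of `a` of large degree is adjacent to everything outside `N(a)`.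
    have hfull : ∀ v, G.Adj a v → (n + 1) / 2 < G.degree v → G.Adj v y ∧ G.Adj v z := by
      intro v hav hv
      have hsub : G.neighborFinset v ⊆ S \ G.neighborFinset a := fun c hc => by
        rw [SimpleGraph.mem_neighborFinset] at hc
        rw [Finset.mem_sdiff, SimpleGraph.mem_neighborFinset]
        exact ⟨hS _ _ hc.symm, fun hac => ha v c hav hac hc⟩
      have heq := Finset.eq_of_subset_of_card_le hsub (by
        rw [Finset.card_sdiff_of_subset (fun c hc => hS c a ((G.mem_neighborFinset a c).1 hc).symm), hn,
          SimpleGraph.card_neighborFinset_eq_degree, SimpleGraph.card_neighborFinset_eq_degree]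
        omega)
      rw [← SimpleGraph.mem_neighborFinset, ← SimpleGraph.mem_neighborFinset, heq]
      simp [hay, haz, hS _ _ hyz, hS _ _ hyz.symm]
    have hcount : ∀ W : Finset V, (∀ v ∈ W, G.Adj v y ∧ G.Adj v z) →
        W.card ≤ (G.cliqueFinset 3).card := by
      intro W hW
      refine Finset.card_le_card_of_injOn (fun v => {v, y, z}) (fun v hv => ?_) fun v hv v' hv' h => ?_
      · simp only [SetLike.mem_coe, SimpleGraph.mem_cliqueFinset_iff,
          SimpleGraph.is3Clique_triple_iff]
        exact ⟨(hW v hv).1, (hW v hv).2, hyz⟩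
      · have hmem : v ∈ ({v', y, z} : Finset V) := by
          rw [← show ({v, y, z} : Finset V) = {v', y, z} from h]; simp
        have h₁ := (hW v hv).1.ne
        have h₂ := (hW v hv).2.ne
        simpa [h₁, h₂] using hmem
    have h₁ := hcount ((G.neighborFinset a).erase u) fun v hv => by
      rw [Finset.mem_erase, SimpleGraph.mem_neighborFinset] at hv
      exact hfull v hv.2 (hnbr v hv.2 hv.1).2
    rw [Finset.card_erase_of_mem (by simpa using hua.symm),
      SimpleGraph.card_neighborFinset_eq_degree] at h₁
    have h₂ := hcount (G.neighborFinset a) fun v hv => by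
      rw [SimpleGraph.mem_neighborFinset] at hv
      by_cases hvu : v = u
      · exact hfull v hv (by rw [hvu]; omega)
      · exact hfull v hv (hnbr v hv hvu).2
    rw [SimpleGraph.card_neighborFinset_eq_degree] at h₂
    omega
  · push Not at hA
    have h₁ : ∀ v ∈ S.erase u, (n + 1) / 2 + 1 ≤ G.degree v := fun v hv =>
      hlarge v (Finset.mem_of_mem_erase hv) (Finset.ne_of_mem_erase hv) (hA v)
    have huS : u ∈ S := by
      obtain ⟨w, hw⟩ : (G.neighborFinset u).Nonempty := by
        rw [← Finset.card_pos, SimpleGraph.card_neighborFinset_eq_degree]; omega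
      exact hS u w (by simpa using hw)
    have h₂ := Finset.card_nsmul_le_sum (S.erase u) (fun v => G.degree v) _ h₁
    rw [hcard u huS, smul_eq_mul] at h₂
    have h₃ := G.sum_degrees_eq_twice_card_edges
    have h₄ : ∑ v ∈ S, G.degree v ≤ ∑ v, G.degree v :=
      Finset.sum_le_sum_of_subset (Finset.subset_univ S)
    rw [← Finset.add_sum_erase S _ huS] at h₄
    have h₅ : n * ((n + 1) / 2 + 1) + 3 ≤ 2 * ((n + 1) ^ 2 / 4 + 1) := by
      rw [← hm']; omega
    obtain ⟨k, rfl | rfl⟩ := n.even_or_odd'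
    · rw [show (2 * k + 1) ^ 2 = 4 * (k ^ 2 + k) + 1 by ring,
        show (2 * k + 1) / 2 = k by omega,
        show (4 * (k ^ 2 + k) + 1) / 4 = k ^ 2 + k by omega] at h₅
      nlinarith
    · rw [show (2 * k + 1 + 1) ^ 2 = 4 * (k ^ 2 + 2 * k + 1) by ring,
        show (2 * k + 1 + 1) / 2 = k + 1 by omega,
        show (4 * (k ^ 2 + 2 * k + 1)) / 4 = k ^ 2 + 2 * k + 1 by omega] at h₅
      nlinarith

end Combinatorics

section TriangleCounting

variable {V : Type*} [Fintype V] [DecidableEq V]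

theorem card_commonNeighbors_le (G : SimpleGraph V) [DecidableRel G.Adj] {u v : V}
    (h : G.Adj u v) : (G.neighborFinset u ∩ G.neighborFinset v).card ≤
      ((G.cliqueFinset 3).filter fun s => u ∈ s ∧ v ∈ s).card := by
  refine Finset.card_le_card_of_injOn (fun w => {w, u, v}) (fun w hw => ?_)
    fun w hw w' hw' heq => ?_
  · simp only [Finset.coe_inter, Set.mem_inter_iff, SetLike.mem_coe,
      SimpleGraph.mem_neighborFinset] at hw
    simp only [SetLike.mem_coe, Finset.mem_filter, SimpleGraph.mem_cliqueFinset_iff,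
      SimpleGraph.is3Clique_triple_iff]
    exact ⟨⟨hw.1.symm, hw.2.symm, h⟩, by simp, by simp⟩
  · simp only [Finset.coe_inter, Set.mem_inter_iff, SetLike.mem_coe,
      SimpleGraph.mem_neighborFinset] at hw
    have hmem : w ∈ ({w', u, v} : Finset V) := by
      rw [← show ({w, u, v} : Finset V) = {w', u, v} from heq]; simp
    simpa [hw.1.ne', hw.2.ne'] using hmem

theorem sum_filter_mem_clique_le (G : SimpleGraph V) [DecidableRel G.Adj] (u : V) {s : Finset V}
    (hs : s ∈ G.cliqueFinset 3) :
    ∑ v ∈ G.neighborFinset u, (if u ∈ s ∧ v ∈ s then 1 else 0) ≤ if u ∈ s then 2 else 0 := by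
  split_ifs with hu
  · rw [← Finset.card_filter]
    have : (s.erase u).card = 2 := by
      rw [Finset.card_erase_of_mem hu, (SimpleGraph.mem_cliqueFinset_iff.1 hs).card_eq]
    rw [← this]
    refine Finset.card_le_card fun v hv => ?_
    simp only [Finset.mem_filter, SimpleGraph.mem_neighborFinset] at hv
    exact Finset.mem_erase.2 ⟨hv.1.ne', hv.2.2⟩
  · simp [hu]

theorem sum_card_commonNeighbors_eq_le (G : SimpleGraph V) [DecidableRel G.Adj] (u : V) :
    ∑ v ∈ G.neighborFinset u, (G.neighborFinset u ∩ G.neighborFinset v).card ≤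
      ∑ s ∈ G.cliqueFinset 3, if u ∈ s then 2 else 0 := by
  calc _ ≤ ∑ v ∈ G.neighborFinset u, ∑ s ∈ G.cliqueFinset 3, if u ∈ s ∧ v ∈ s then 1 else 0 := by
        refine Finset.sum_le_sum fun v hv => ?_
        rw [← Finset.card_filter]
        exact card_commonNeighbors_le G (by simpa using hv)
    _ = ∑ s ∈ G.cliqueFinset 3, ∑ v ∈ G.neighborFinset u, if u ∈ s ∧ v ∈ s then 1 else 0 :=
        Finset.sum_comm
    _ ≤ _ := Finset.sum_le_sum fun s hs => sum_filter_mem_clique_le G u hs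

theorem sum_card_commonNeighbors_le (G : SimpleGraph V) [DecidableRel G.Adj] (u : V) :
    ∑ v ∈ G.neighborFinset u, (G.neighborFinset u ∩ G.neighborFinset v).card ≤
      2 * (G.cliqueFinset 3).card := by
  refine (sum_card_commonNeighbors_eq_le G u).trans ?_
  rw [mul_comm, ← smul_eq_mul]
  exact Finset.sum_le_card_nsmul _ _ _ fun s _ => by split_ifs <;> simp

theorem sum_sum_card_commonNeighbors_le (G : SimpleGraph V) [DecidableRel G.Adj] :
    ∑ u, ∑ v ∈ G.neighborFinset u, (G.neighborFinset u ∩ G.neighborFinset v).card ≤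
      6 * (G.cliqueFinset 3).card := by
  refine (Finset.sum_le_sum fun u _ => sum_card_commonNeighbors_eq_le G u).trans ?_
  rw [Finset.sum_comm, mul_comm, ← smul_eq_mul]
  refine Finset.sum_le_card_nsmul _ _ _ fun s hs => ?_
  rw [Finset.sum_ite_mem, Finset.univ_inter, Finset.sum_const,
    (SimpleGraph.mem_cliqueFinset_iff.1 hs).card_eq]
  rfl

end TriangleCounting

section Perron

variable {V : Type*} [Fintype V]

theorem sum_sum_neighborFinset_comm (G : SimpleGraph V) [DecidableRel G.Adj] (f : V → V → ℝ) :
    ∑ u, ∑ v ∈ G.neighborFinset u, f u v = ∑ v, ∑ u ∈ G.neighborFinset v, f u v :=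
  Finset.sum_comm' fun u v => by simp [G.adj_comm]

variable [DecidableEq V]

/-- The weighted Mantel inequality, summing `x` over the neighbourhoods of both ends of every
edge. -/
theorem sq_mul_sum_le (G : SimpleGraph V) [DecidableRel G.Adj] {x : V → ℝ} {l M : ℝ}
    (hx : ∀ v, 0 ≤ x v) (hM : ∀ v, x v ≤ M) (hM0 : 0 ≤ M)
    (heig : ∀ v, ∑ w ∈ G.neighborFinset v, x w = l * x v) :
    l ^ 2 * ∑ v, x v ≤ G.edgeFinset.card * ∑ v, x v + 3 * (G.cliqueFinset 3).card * M := by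
  have hdeg : ∑ u, ∑ v ∈ G.neighborFinset u, x u = l * ∑ v, x v := by
    rw [sum_sum_neighborFinset_comm, Finset.mul_sum]
    exact Finset.sum_congr rfl fun v _ => heig v
  have hlhs : ∑ u, ∑ v ∈ G.neighborFinset u, (l * x u + l * x v) = 2 * (l ^ 2 * ∑ v, x v) := by
    simp_rw [Finset.sum_add_distrib, ← Finset.mul_sum, heig]
    rw [hdeg, ← Finset.mul_sum]
    ring
  have hedge : ∀ u, ∀ v ∈ G.neighborFinset u, l * x u + l * x v ≤
      ∑ w, x w + (G.neighborFinset u ∩ G.neighborFinset v).card * M := by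
    intro u v _
    rw [← heig, ← heig, ← Finset.sum_union_inter]
    refine add_le_add (Finset.sum_le_sum_of_subset_of_nonneg (Finset.subset_univ _)
      fun w _ _ => hx w) ?_
    rw [← nsmul_eq_mul]
    exact Finset.sum_le_card_nsmul _ _ _ fun w _ => hM w
  have hsum := Finset.sum_le_sum fun u (_ : u ∈ Finset.univ) => Finset.sum_le_sum (hedge u)
  have hrhs : ∑ u, ∑ v ∈ G.neighborFinset u,
      (∑ w, x w + (G.neighborFinset u ∩ G.neighborFinset v).card * M) =
      (∑ u, (G.degree u : ℝ)) * ∑ w, x w +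
        (∑ u, ∑ v ∈ G.neighborFinset u,
          ((G.neighborFinset u ∩ G.neighborFinset v).card : ℝ)) * M := by
    simp_rw [Finset.sum_add_distrib, Finset.sum_const, SimpleGraph.card_neighborFinset_eq_degree,
      nsmul_eq_mul, ← Finset.sum_mul]
  rw [hlhs, hrhs] at hsum
  have ht : (∑ u, ∑ v ∈ G.neighborFinset u,
      ((G.neighborFinset u ∩ G.neighborFinset v).card : ℝ)) ≤ 6 * (G.cliqueFinset 3).card := by
    exact_mod_cast sum_sum_card_commonNeighbors_le G
  have hd : (∑ u, (G.degree u : ℝ)) = 2 * G.edgeFinset.card := by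
    exact_mod_cast G.sum_degrees_eq_twice_card_edges
  rw [hd] at hsum
  nlinarith [mul_le_mul_of_nonneg_right ht hM0]

/-- Counting weighted walks of length two from a vertex `u` of maximum weight. -/
theorem sq_mul_le (G : SimpleGraph V) [DecidableRel G.Adj] {x : V → ℝ} {l : ℝ} {u : V}
    (hx : ∀ v, 0 ≤ x v) (hM : ∀ v, x v ≤ x u)
    (heig : ∀ v, ∑ w ∈ G.neighborFinset v, x w = l * x v) :
    l ^ 2 * x u ≤ G.degree u * x u + 2 * (G.cliqueFinset 3).card * x u +
      G.degree u * (∑ v, x v - x u - l * x u) := by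
  have h₁ : l ^ 2 * x u = ∑ w, (G.neighborFinset u ∩ G.neighborFinset w).card * x w := by
    calc l ^ 2 * x u = ∑ v ∈ G.neighborFinset u, ∑ w ∈ G.neighborFinset v, x w := by
          simp_rw [heig]
          rw [← Finset.mul_sum, heig]; ring
      _ = ∑ w, ∑ v ∈ G.neighborFinset u ∩ G.neighborFinset w, x w :=
          Finset.sum_comm' fun v w => by simp [G.adj_comm]
      _ = _ := by simp
  have h₂ : ∀ f : V → ℝ, ∑ w, f w = f u + ∑ w ∈ G.neighborFinset u, f w +
      ∑ w ∈ (Finset.univ.erase u) \ G.neighborFinset u, f w := by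
    intro f
    rw [← Finset.add_sum_erase _ _ (Finset.mem_univ u), add_assoc, add_comm (∑ w ∈ _, f w),
      Finset.sum_sdiff (fun w hw => ?_)]
    rw [SimpleGraph.mem_neighborFinset] at hw
    simp [hw.ne']
  have h₃ := h₂ x
  rw [heig] at h₃
  rw [h₁, h₂, h₃, Finset.inter_self, SimpleGraph.card_neighborFinset_eq_degree]
  refine add_le_add (add_le_add le_rfl ?_) ?_
  · have ht : (∑ v ∈ G.neighborFinset u, ((G.neighborFinset u ∩ G.neighborFinset v).card : ℝ)) ≤
        2 * (G.cliqueFinset 3).card := by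
      exact_mod_cast sum_card_commonNeighbors_le G u
    refine le_trans ?_ (mul_le_mul_of_nonneg_right ht (hx u))
    rw [Finset.sum_mul]
    gcongr with w
    exact hM w
  · rw [sub_sub, add_sub_cancel_left, Finset.mul_sum]
    gcongr with w
    · exact hx w
    · rw [← SimpleGraph.card_neighborFinset_eq_degree]
      exact Finset.card_le_card Finset.inter_subset_left

end Perron

section SpectralRadius

open Classical in
theorem le_specRad {V : Type*} [Fintype V] (G : SimpleGraph V) {y : V → ℝ} {θ : ℝ} (hy : y ≠ 0)
    (h : ∀ v, ∑ w, (if G.Adj v w then y w else 0) = θ * y v) : θ ≤ specRad G := by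
  refine le_csSup (Module.End.finite_hasEigenvalue _).bddAbove ?_
  refine Module.End.hasEigenvalue_of_hasEigenvector (x := y)
    (Module.End.hasEigenvector_iff.2 ⟨?_, hy⟩)
  rw [Module.End.mem_eigenspace_iff, Matrix.toLin'_apply]
  ext v
  rw [Pi.smul_apply, smul_eq_mul, ← h v]
  simp [Matrix.mulVec, dotProduct, SimpleGraph.adjMatrix_apply]

theorem sum_fin_eq_of_blocks (b c : ℕ) (f : ℕ → ℝ) {e₀ e₁ e₂ e₃ : ℝ} (h₀ : f 0 = e₀)
    (h₁ : f 1 = e₁) (h₂ : ∀ i < c, f (2 + i) = e₂) (h₃ : ∀ i < b, f (2 + c + i) = e₃) :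
    ∑ i : Fin (2 + c + b), f i = e₀ + e₁ + c * e₂ + b * e₃ := by
  rw [Fin.sum_univ_eq_sum_range f, Finset.sum_range_add, Finset.sum_range_add,
    Finset.sum_congr rfl fun i hi => h₂ i (Finset.mem_range.1 hi),
    Finset.sum_congr rfl fun i hi => h₃ i (Finset.mem_range.1 hi)]
  simp [Finset.sum_range_succ, h₀, h₁]

open Classical in
/-- The eigenvalue equation for a vector that is constant on the blocks of `KbipPlus`. -/
theorem sum_ite_adj_eq_of_blocks (b c : ℕ) {θ : ℝ} {y : ℕ → ℝ} {R : ℕ → ℕ → Prop}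
    (h : θ ^ 2 * (θ - 1) = (2 + c) * b * (θ - 1) + 2 * b)
    (hR : ∀ i j, R i j ↔ i ≠ j ∧ (((i < 2 + c ∧ 2 + c ≤ j) ∨ (i = 0 ∧ j = 1)) ∨
      ((j < 2 + c ∧ 2 + c ≤ i) ∨ (j = 0 ∧ i = 1))))
    (y₀ : y 0 = b * θ) (y₁ : y 1 = b * θ) (y₂ : ∀ i < c, y (2 + i) = b * (θ - 1))
    (y₃ : ∀ i, y (2 + c + i) = θ * (θ - 1)) {v : ℕ} :
    ∑ w : Fin (2 + c + b), (if R v w then y w else 0) = θ * y v := by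
  have key := @sum_fin_eq_of_blocks b c (fun w => if R v w then y w else 0)
  have hv : v = 0 ∨ v = 1 ∨ (2 ≤ v ∧ v < 2 + c) ∨ 2 + c ≤ v := by omega
  rcases hv with hv | hv | ⟨hv₁, hv₂⟩ | hv₁
  · refine (key (e₀ := 0) (e₁ := b * θ) (e₂ := 0) (e₃ := θ * (θ - 1)) ?_ ?_ ?_ ?_).trans ?_
    · exact if_neg (by rw [hR]; omega)
    · exact (if_pos (by rw [hR]; omega)).trans y₁
    · exact fun i hi => if_neg (by rw [hR]; omega)
    · exact fun i hi => (if_pos (by rw [hR]; omega)).trans (y₃ i)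
    · rw [hv, y₀]; ring
  · refine (key (e₀ := b * θ) (e₁ := 0) (e₂ := 0) (e₃ := θ * (θ - 1)) ?_ ?_ ?_ ?_).trans ?_
    · exact (if_pos (by rw [hR]; omega)).trans y₀
    · exact if_neg (by rw [hR]; omega)
    · exact fun i hi => if_neg (by rw [hR]; omega)
    · exact fun i hi => (if_pos (by rw [hR]; omega)).trans (y₃ i)
    · rw [hv, y₁]; ring
  · refine (key (e₀ := 0) (e₁ := 0) (e₂ := 0) (e₃ := θ * (θ - 1)) ?_ ?_ ?_ ?_).trans ?_
    · exact if_neg (by rw [hR]; omega)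
    · exact if_neg (by rw [hR]; omega)
    · exact fun i hi => if_neg (by rw [hR]; omega)
    · exact fun i hi => (if_pos (by rw [hR]; omega)).trans (y₃ i)
    · obtain ⟨j, rfl⟩ := Nat.exists_eq_add_of_le hv₁
      rw [y₂ j (by omega)]; ring
  · refine (key (e₀ := b * θ) (e₁ := b * θ) (e₂ := b * (θ - 1)) (e₃ := 0) ?_ ?_ ?_ ?_).trans ?_
    · exact (if_pos (by rw [hR]; omega)).trans y₀
    · exact (if_pos (by rw [hR]; omega)).trans y₁
    · exact fun i hi => (if_pos (by rw [hR]; omega)).trans (y₂ i hi)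
    · exact fun i hi => if_neg (by rw [hR]; omega)
    · obtain ⟨j, rfl⟩ := Nat.exists_eq_add_of_le hv₁
      rw [y₃]
      linear_combination -h

open Classical in
theorem le_specRad_KbipPlus (b c : ℕ) {θ : ℝ} (hθ : 1 < θ)
    (h : θ ^ 2 * (θ - 1) = (2 + c) * b * (θ - 1) + 2 * b) :
    θ ≤ specRad (KbipPlus (2 + c + b) (2 + c)) := by
  obtain ⟨y, hy⟩ : ∃ y : ℕ → ℝ, ∀ i, y i = if i < 2 then b * θ else if i < 2 + c then b * (θ - 1)
    else θ * (θ - 1) := ⟨_, fun _ => rfl⟩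
  have y₀ : y 0 = b * θ := by simp [hy]
  have y₁ : y 1 = b * θ := by simp [hy]
  have y₂ : ∀ i < c, y (2 + i) = b * (θ - 1) := fun i hi => by
    rw [hy, if_neg (by omega), if_pos (by omega)]
  have y₃ : ∀ i, y (2 + c + i) = θ * (θ - 1) := fun i => by
    rw [hy, if_neg (by omega), if_neg (by omega)]
  obtain ⟨R, hR⟩ : ∃ R : ℕ → ℕ → Prop, ∀ i j, R i j ↔ i ≠ j ∧
      (((i < 2 + c ∧ 2 + c ≤ j) ∨ (i = 0 ∧ j = 1)) ∨
        ((j < 2 + c ∧ 2 + c ≤ i) ∨ (j = 0 ∧ i = 1))) := ⟨_, fun _ _ => Iff.rfl⟩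
  have hadj : ∀ v w : Fin (2 + c + b),
      (KbipPlus (2 + c + b) (2 + c)).Adj v w ↔ R v w := fun v w => by
    rw [hR, KbipPlus, SimpleGraph.fromRel_adj, ne_eq, Fin.ext_iff]
  have hb : (b : ℝ) ≠ 0 := by
    rintro hb
    rw [hb] at h
    have : 0 < θ ^ 2 * (θ - 1) := mul_pos (by positivity) (sub_pos.2 hθ)
    linarith
  have hpos : 0 < 2 + c + b := by omega
  refine le_specRad _ (y := fun v : Fin (2 + c + b) => y v) (fun h0 => ?_) fun v => ?_
  · have h0 : y 0 = 0 := congrFun h0 (Fin.mk 0 hpos)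
    rw [y₀, mul_eq_zero] at h0
    exact h0.elim hb fun h => by linarith
  · rw [← sum_ite_adj_eq_of_blocks b c h hR y₀ y₁ y₂ y₃]
    exact Finset.sum_congr rfl fun w _ => if_congr (hadj v w) rfl rfl

/-- The characteristic cubic of `K⁺`, as a lower bound on its spectral radius. -/
theorem two_mul_le_of_specRad_Kplus_le {n : ℕ} (hn : 3 ≤ n) {l : ℝ} (hl : specRad (Kplus n) ≤ l) :
    1 < l ∧ ((n ^ 2 / 4 : ℕ) : ℝ) < l ^ 2 ∧
      2 * ((n / 2 : ℕ) : ℝ) ≤ (l ^ 2 - ((n ^ 2 / 4 : ℕ) : ℝ)) * (l - 1) := by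
  obtain ⟨b, c, rfl, hb, hc, hcb⟩ : ∃ b c, n = 2 + c + b ∧ (2 + c + b) / 2 = b ∧
      (2 + c + b + 1) / 2 = 2 + c ∧ 1 ≤ b :=
    ⟨n / 2, (n + 1) / 2 - 2, by omega, by omega, by omega, by omega⟩
  have hf : (2 + c + b) ^ 2 / 4 = (2 + c) * b := by
    obtain h | h : b = 2 + c ∨ b = 1 + c := by omega
    · subst h
      rw [show (2 + c + (2 + c)) ^ 2 = 4 * ((2 + c) * (2 + c)) by ring]; omega
    · subst h
      rw [show (2 + c + (1 + c)) ^ 2 = 4 * ((2 + c) * (1 + c)) + 1 by ring]; omega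
  have hbc : (2 + c : ℝ) ≤ b + 1 := by
    have : 2 + c ≤ b + 1 := by omega
    exact_mod_cast this
  have hb1 : (1 : ℝ) ≤ b := by exact_mod_cast hcb
  have hc0 : (0 : ℝ) ≤ c := c.cast_nonneg
  rw [hb, hf]
  rw [Kplus, hc] at hl
  push_cast
  set P : ℝ := (2 + c) * b with hP
  have hP2 : 2 ≤ P := by nlinarith
  have hs : 1 < √P := by
    rw [Real.lt_sqrt] <;> linarith
  have hsP : √P ^ 2 = P := Real.sq_sqrt (by linarith)
  have hsb : √P ≤ b + 2 := by
    rw [Real.sqrt_le_left (by linarith)]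
    nlinarith
  obtain ⟨θ, ⟨hθ₁, hθ₂⟩, hθ⟩ : 2 * (b : ℝ) ∈ (fun t : ℝ => (t ^ 2 - P) * (t - 1)) ''
      Set.Icc (√P) (b + 2) := by
    refine intermediate_value_Icc hsb (by fun_prop) ⟨?_, ?_⟩
    · change (√P ^ 2 - P) * (√P - 1) ≤ _
      rw [hsP]; linarith
    · change _ ≤ (((b : ℝ) + 2) ^ 2 - P) * (b + 2 - 1)
      nlinarith
  simp only at hθ
  have hθ1 : 1 < θ := hs.trans_le hθ₁
  have hle := (le_specRad_KbipPlus b c hθ1 (by rw [← hP]; linarith)).trans hl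
  have hθP : P < θ ^ 2 := by
    by_contra! h
    nlinarith
  have hsq : θ ^ 2 ≤ l ^ 2 := by gcongr
  refine ⟨by linarith, by linarith, ?_⟩
  rw [← hθ]
  gcongr
  linarith

end SpectralRadius

theorem triangleCount_eq_card_cliqueFinset {V : Type*} [Fintype V] [DecidableEq V]
    (G : SimpleGraph V) [DecidableRel G.Adj] : triangleCount G = (G.cliqueFinset 3).card := by
  unfold triangleCount
  congr!

/-- The number of edges of a graph with few triangles and spectral radius at least that of
`K⁺`. -/
theorem sq_div_four_lt_card_edgeFinset {n : ℕ} (G : SimpleGraph (Fin n)) [DecidableRel G.Adj]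
    {x : Fin n → ℝ} {l : ℝ} {u : Fin n} (ht : (G.cliqueFinset 3).card ≤ n / 2)
    (hl1 : 1 < l)
    (hcubic : 2 * ((n / 2 : ℕ) : ℝ) ≤ (l ^ 2 - ((n ^ 2 / 4 : ℕ) : ℝ)) * (l - 1))
    (hbl : ((n / 2 : ℕ) : ℝ) < l) (hb : 1 ≤ n / 2)
    (hx : ∀ v, 0 < x v) (hu : ∀ v, x v ≤ x u)
    (heig : ∀ v, ∑ w ∈ G.neighborFinset v, x w = l * x v) :
    n ^ 2 / 4 < G.edgeFinset.card := by
  by_contra! hm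
  have h₁ := sq_mul_sum_le G (fun v => (hx v).le) hu (hx u).le heig
  have h₂ := sq_mul_le G (fun v => (hx v).le) hu heig
  have hd : G.degree u ≤ 2 * (n / 2) := by
    have := G.degree_lt_card_verts u
    rw [Fintype.card_fin] at this
    omega
  have hβ : 0 ≤ ∑ v, x v - x u - l * x u := by
    rw [← heig u, sub_sub, sub_nonneg, ← Finset.sum_insert (by simp)]
    exact Finset.sum_le_sum_of_subset_of_nonneg (Finset.subset_univ _) fun v _ _ => (hx v).le
  have hM := hx u
  have hmR : (G.edgeFinset.card : ℝ) ≤ ((n ^ 2 / 4 : ℕ) : ℝ) := by exact_mod_cast hm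
  have htR : ((G.cliqueFinset 3).card : ℝ) ≤ ((n / 2 : ℕ) : ℝ) := by exact_mod_cast ht
  have hdR : (G.degree u : ℝ) ≤ 2 * ((n / 2 : ℕ) : ℝ) := by exact_mod_cast hd
  have hbR : (1 : ℝ) ≤ ((n / 2 : ℕ) : ℝ) := by exact_mod_cast hb
  generalize (G.edgeFinset.card : ℝ) = m at *
  generalize ((G.cliqueFinset 3).card : ℝ) = t at *
  generalize (G.degree u : ℝ) = d at *
  generalize ((n / 2 : ℕ) : ℝ) = b at *
  generalize ((n ^ 2 / 4 : ℕ) : ℝ) = P at *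
  generalize x u = M at *
  generalize ∑ v, x v = S at *
  have hS : 0 ≤ S := by nlinarith
  have h₃ : (l ^ 2 - P) * S ≤ 3 * b * M := by
    nlinarith [mul_le_mul_of_nonneg_right hmR hS, mul_le_mul_of_nonneg_right htR hM.le]
  have h₄ : 2 * S ≤ 3 * M * (l - 1) := by
    have h₅ := mul_le_mul_of_nonneg_right h₃ (sub_nonneg.2 hl1.le)
    have h₆ := mul_le_mul_of_nonneg_right hcubic hS
    refine le_of_mul_le_mul_left ?_ (show 0 < b by linarith)
    linarith
  have h₅ : 2 * (S - M - l * M) ≤ M * (l - 5) := by linarith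
  have h₆ : 0 ≤ l - 5 := by
    by_contra! h
    nlinarith
  have h₇ : d * (2 * M + 2 * (S - M - l * M)) ≤ 2 * b * (M * (l - 3)) := by
    refine mul_le_mul hdR (by linarith) ?_ (by linarith)
    nlinarith
  have h₈ : t * M ≤ b * M := mul_le_mul_of_nonneg_right htR hM.le
  have h₉ : l ^ 2 * M ≤ b * (l - 1) * M := by linarith
  have h₁₀ := le_of_mul_le_mul_right h₉ hM
  nlinarith

/-- In the Setup, the degree of `u*` satisfies `|A| = t(G) + 1`. -/
theorem setup_degree_eq_triangles_add_one
    (n : ℕ) (hn : 3 ≤ n) (G : SimpleGraph (Fin n)) [DecidableRel G.Adj]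
    (ht : triangleCount G ≤ n / 2)
    (hspec : specRad (Kplus n) ≤ specRad G)
    (hmaxspec : ∀ H : SimpleGraph (Fin n), triangleCount H ≤ n / 2 → specRad H ≤ specRad G)
    (hconn : G.Connected)
    (x : Fin n → ℝ) (hxpos : ∀ v, 0 < x v) (hxunit : ∑ v, x v ^ 2 = 1)
    (heig : SimpleGraph.adjMatrix ℝ G *ᵥ x = specRad G • x)
    (ustar : Fin n) (hustar : ∀ v, x v ≤ x ustar)
    :
    G.degree ustar = triangleCount G + 1 := by
  rw [triangleCount_eq_card_cliqueFinset] at ht ⊢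
  obtain ⟨hl1, hlsq, hcubic⟩ := two_mul_le_of_specRad_Kplus_le hn hspec
  have heig' : ∀ v, ∑ w ∈ G.neighborFinset v, x w = specRad G * x v := fun v => by
    rw [← SimpleGraph.adjMatrix_mulVec_apply, heig, Pi.smul_apply, smul_eq_mul]
  have hbl : ((n / 2 : ℕ) : ℝ) < specRad G := by
    refine lt_of_pow_lt_pow_left₀ 2 (by linarith) (lt_of_le_of_lt ?_ hlsq)
    norm_cast
    rw [Nat.le_div_iff_mul_le (by norm_num)]
    have : 2 * (n / 2) ≤ n := Nat.mul_div_le n 2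
    nlinarith
  have hld : specRad G ≤ G.degree ustar := by
    refine le_of_mul_le_mul_right ?_ (hxpos ustar)
    rw [← heig', ← nsmul_eq_mul, ← SimpleGraph.card_neighborFinset_eq_degree]
    exact Finset.sum_le_card_nsmul _ _ _ fun v _ => hustar v
  have hbd : n / 2 < G.degree ustar := by exact_mod_cast hbl.trans_le hld
  have hm := sq_div_four_lt_card_edgeFinset G ht hl1 hcubic hbl (by omega) hxpos hustar heig'
  by_contra hne
  have := card_edgeFinset_le_of_card_cliqueFinset_add_two_le _ Finset.univ G rfl
    (fun _ _ _ => Finset.mem_univ _) ustar (by omega)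
  rw [Finset.card_univ, Fintype.card_fin] at this
  omega
end

section
/- Let F be a finite graph with chromatic number r + 1, where r ≥ 1, and let f be the number of vertices of F. For every ε > 0 there exist δ > 0 and a natural number n₀ such that every simple graph G on n ≥ n₀ vertices with λ(G) ≥ (1 − 1/r + ε)·n contains at least δ·n^f copies of F, where the number of copies of F in G is counted as the number of injective graph homomorphisms from F into G. -/
open Matrix

open Finset

/-- The edge version of the Erdős–Stone theorem, for one suitable number of vertices. -/
theorem exists_two_mul_card_edgeFinset_le_of_free {α : Type*} [Fintype α] {F : SimpleGraph α}
    {r : ℕ} (hr : 1 ≤ r) (hF : F.Colorable (r + 1)) {ε : ℝ} (hε : 0 < ε) :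
    ∃ m : ℕ, 2 ≤ m ∧ ∀ (K : SimpleGraph (Fin m)) [DecidableRel K.Adj], F.Free K →
      2 * (#K.edgeFinset : ℝ) ≤ (1 - 1 / (r : ℝ) + ε) * (m * (m - 1)) := by
  classical
  obtain ⟨C⟩ := hF
  have hr' : (1 : ℝ) / r ≤ 1 := by
    rw [div_le_one (by positivity)]
    exact_mod_cast hr
  have hFE : F.IsContained (SimpleGraph.completeEquipartiteGraph (r + 1) (Fintype.card α)) :=
    SimpleGraph.isContained_completeEquipartiteGraph_of_colorable C _
      fun c ↦ Fintype.card_subtype_le _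
  obtain ⟨n₀, hn₀⟩ := Filter.eventually_atTop.mp
    (SimpleGraph.eventually_completeEquipartiteGraph_isContained_of_minDegree
      (half_pos hε) r (Fintype.card α))
  set c : ℝ := 1 - 1 / (r : ℝ) + ε / 2 with hc
  have hc0 : 0 < c := by linarith
  have hstep (n : ℕ) (hn : n₀ ≤ n) : (SimpleGraph.extremalNumber (n + 1) F : ℝ) ≤
      SimpleGraph.extremalNumber n F + c * (n + 1) := by
    conv_lhs => rw [← Fintype.card_fin (n + 1)]
    rw [SimpleGraph.extremalNumber_le_iff_of_nonneg _ (by positivity)]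
    intro G _ hG
    have hdeg : (G.minDegree : ℝ) < c * (n + 1) := by
      by_contra! h
      exact hG (hFE.trans (hn₀ (n + 1) (by lia) (by exact_mod_cast h)))
    obtain ⟨v, hv⟩ := G.exists_minimal_degree_vertex
    have h₁ := SimpleGraph.card_edgeFinset_deleteIncidenceSet_le_extremalNumber hG v
    have h₂ := G.card_edgeFinset_deleteIncidenceSet v
    rw [Fintype.card_fin, Nat.add_sub_cancel] at h₁
    have h₃ : #G.edgeFinset ≤ SimpleGraph.extremalNumber n F + G.minDegree := by lia
    have h₄ : (#G.edgeFinset : ℝ) ≤ SimpleGraph.extremalNumber n F + G.minDegree := by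
      exact_mod_cast h₃
    linarith
  set D : ℝ := 2 * SimpleGraph.extremalNumber n₀ F with hD
  have hbound (n : ℕ) (hn : n₀ ≤ n) :
      2 * (SimpleGraph.extremalNumber n F : ℝ) ≤ D + c * (n * (n + 1)) := by
    induction n, hn using Nat.le_induction with
    | base => simp only [← hD, le_add_iff_nonneg_right]; positivity
    | succ n hn ih =>
      have := hstep n hn
      push_cast
      linarith
  obtain ⟨k, hk⟩ := exists_nat_ge ((D + 2 * c) * 2 / ε)
  rw [div_le_iff₀ hε] at hk
  refine ⟨k + n₀ + 2, by lia, fun K _ hK ↦ ?_⟩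
  have h₁ := SimpleGraph.card_edgeFinset_le_extremalNumber hK
  rw [Fintype.card_fin] at h₁
  have h₂ : (#K.edgeFinset : ℝ) ≤ SimpleGraph.extremalNumber (k + n₀ + 2) F := by
    exact_mod_cast h₁
  have h₃ := hbound (k + n₀ + 2) (by lia)
  set m : ℝ := ((k + n₀ + 2 : ℕ) : ℝ) with hm
  have hm' : (k : ℝ) + 1 ≤ m := by
    rw [hm]
    exact_mod_cast (by lia : k + 1 ≤ k + n₀ + 2)
  have hk0 : (0 : ℝ) ≤ k := k.cast_nonneg
  have hD0 : 0 ≤ D := by positivity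
  have hcε : 1 - 1 / (r : ℝ) + ε = c + ε / 2 := by rw [hc]; ring
  rw [hcε]
  have h₄ : D + 2 * c ≤ ε / 2 * (m - 1) := by nlinarith
  nlinarith [mul_le_mul_of_nonneg_right h₄ (by linarith : 0 ≤ m)]

/-- Sampling independently from a probability vector `p`, the coordinates picked out by an
embedding are again independent samples from `p`. -/
theorem sum_prod_mul_comp_embedding {ι β V R : Type*} [Fintype ι] [Fintype β] [Fintype V]
    [DecidableEq ι] [DecidableEq β] [CommRing R] (p : V → R) (hp : ∑ x, p x = 1) (ψ : β ↪ ι)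
    (g : (β → V) → R) :
    ∑ v : ι → V, (∏ i, p (v i)) * g (v ∘ ψ) = ∑ u : β → V, (∏ b, p (u b)) * g u := by
  classical
  have key (u : β → V) :
      ∑ v : ι → V, (∏ i, p (v i)) * (if v ∘ ψ = u then 1 else 0) = ∏ b, p (u b) := by
    have h₁ (v : ι → V) : (∏ i, p (v i)) * (if v ∘ ψ = u then 1 else 0) =
        ∏ i, p (v i) * (if ∀ b, ψ b = i → v i = u b then 1 else 0) := by
      rw [prod_mul_distrib, Finset.prod_ite_zero]
      congr 1
      rw [prod_const_one]
      have hiff : v ∘ ψ = u ↔ ∀ i ∈ univ, ∀ b, ψ b = i → v i = u b :=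
        ⟨fun h i _ b hb ↦ by rw [← h, ← hb, Function.comp_apply],
          fun h ↦ funext fun b ↦ h _ (mem_univ _) b rfl⟩
      by_cases h : v ∘ ψ = u
      · rw [if_pos h, if_pos (hiff.mp h)]
      · rw [if_neg h, if_neg (mt hiff.mpr h)]
    simp_rw [h₁]
    rw [← Fintype.prod_sum fun i x ↦ p x * (if ∀ b, ψ b = i → x = u b then 1 else 0)]
    symm
    refine Fintype.prod_of_injective ψ ψ.injective _ _ (fun i hi ↦ ?_) (fun b ↦ ?_)
    · have h₂ : ∀ b, ψ b ≠ i := fun b hb ↦ hi ⟨b, hb⟩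
      simpa [h₂] using hp
    · simp [ψ.injective.eq_iff]
  calc ∑ v : ι → V, (∏ i, p (v i)) * g (v ∘ ψ)
    _ = ∑ v : ι → V, ∑ u : β → V, (∏ i, p (v i)) * (if v ∘ ψ = u then 1 else 0) * g u := by
      refine sum_congr rfl fun v _ ↦ ?_
      simp
    _ = ∑ u : β → V, (∏ b, p (u b)) * g u := by
      rw [sum_comm]
      simp_rw [← sum_mul, key]

open scoped Classical in
/-- If every `F`-free graph on `m` vertices has edge density at most `c`, then a graph whose
weighted edge density exceeds `c` by `η` has positive weighted density of homomorphisms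
from `F`. -/
theorem le_card_embedding_mul_weighted_hom_density {α V : Type*} [Fintype α] [Fintype V]
    (F : SimpleGraph α) (G : SimpleGraph V) {p : V → ℝ} (hp0 : ∀ x, 0 ≤ p x)
    (hp : ∑ x, p x = 1) {c η : ℝ} (hc : 0 ≤ c) {m : ℕ} (hm : 2 ≤ m)
    (hfree : ∀ (K : SimpleGraph (Fin m)) [DecidableRel K.Adj], F.Free K →
      2 * (#K.edgeFinset : ℝ) ≤ c * (m * (m - 1)))
    (hG : c + η ≤ ∑ x, ∑ y, p x * p y * (if G.Adj x y then 1 else 0)) :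
    η ≤ Fintype.card (α ↪ Fin m) *
      ∑ u : α → V, (∏ a, p (u a)) * (if ∀ a b, F.Adj a b → G.Adj (u a) (u b) then 1 else 0) := by
  set t : ℝ := ∑ u : α → V, (∏ a, p (u a)) *
    (if ∀ a b, F.Adj a b → G.Adj (u a) (u b) then 1 else 0)
  have hM : (0 : ℝ) < m * (m - 1) := by
    have : (2 : ℝ) ≤ m := by exact_mod_cast hm
    exact mul_pos (by linarith) (by linarith)
  set M : ℝ := m * (m - 1) with hMdef
  have htot : ∑ v : Fin m → V, ∏ i, p (v i) = 1 := by
    rw [← Fintype.prod_sum fun (_ : Fin m) x ↦ p x]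
    simp [hp]
  have hpt (v : Fin m → V) :
      ∑ i, ∑ j, (if G.Adj (v i) (v j) then (1 : ℝ) else 0) ≤ c * M + M *
        ∑ ψ : α ↪ Fin m,
          (if ∀ a b, F.Adj a b → G.Adj ((v ∘ ψ) a) ((v ∘ ψ) b) then 1 else 0) := by
    set S : ℝ := ∑ ψ : α ↪ Fin m,
      (if ∀ a b, F.Adj a b → G.Adj ((v ∘ ψ) a) ((v ∘ ψ) b) then 1 else 0)
    have hS : 0 ≤ S := sum_nonneg fun _ _ ↦ by split_ifs <;> norm_num
    have hedges : ∑ i, ∑ j, (if G.Adj (v i) (v j) then (1 : ℝ) else 0) =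
        2 * (#(G.comap v).edgeFinset : ℝ) := by
      have := (G.comap v).two_mul_card_edgeFinset
      rw [← Fintype.sum_prod_type' fun i j ↦ if G.Adj (v i) (v j) then (1 : ℝ) else 0,
        sum_boole]
      have h := congrArg (Nat.cast : ℕ → ℝ) this
      push_cast at h
      rw [h]
      congr
    rw [hedges]
    by_cases hK : F.Free (G.comap v)
    · have hle := hfree _ hK
      have hMS : 0 ≤ M * S := by positivity
      exact le_add_of_le_of_nonneg hle hMS
    · obtain ⟨f⟩ := not_not.mp hK
      have hS1 : 1 ≤ S := by
        refine le_trans ?_ (single_le_sum (fun _ _ ↦ by split_ifs <;> norm_num)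
          (mem_univ (⟨f, f.injective⟩ : α ↪ Fin m)))
        rw [if_pos]
        intro a b hab
        exact f.toHom.map_adj hab
      have hle := (G.comap v).card_edgeFinset_le_card_choose_two
      rw [Fintype.card_fin] at hle
      have hle' : (#(G.comap v).edgeFinset : ℝ) ≤ m.choose 2 := by exact_mod_cast hle
      rw [Nat.cast_choose_two] at hle'
      nlinarith
  have hpair (i j : Fin m) (hij : i ≠ j) :
      ∑ v : Fin m → V, (∏ k, p (v k)) * (if G.Adj (v i) (v j) then 1 else 0) =
        ∑ x, ∑ y, p x * p y * (if G.Adj x y then 1 else 0) := by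
    have hψ : Function.Injective ![i, j] := by
      rw [Function.Injective]
      simp [Fin.forall_fin_two, hij, hij.symm]
    let A : V → V → ℝ := fun x y ↦ if G.Adj x y then 1 else 0
    have h : ∑ v : Fin m → V, (∏ k, p (v k)) * A (v i) (v j) =
        ∑ u : Fin 2 → V, (∏ b, p (u b)) * A (u 0) (u 1) :=
      sum_prod_mul_comp_embedding p hp ⟨![i, j], hψ⟩ fun u ↦ A (u 0) (u 1)
    rw [h, ← (finTwoArrowEquiv V).symm.sum_comp, Fintype.sum_prod_type]
    simp [finTwoArrowEquiv, A]
  have hlower : M * (c + η) ≤ ∑ v : Fin m → V, (∏ k, p (v k)) *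
      ∑ i, ∑ j, (if G.Adj (v i) (v j) then (1 : ℝ) else 0) := by
    simp_rw [mul_sum]
    rw [sum_comm]
    have h₁ (i : Fin m) : (m - 1) * (c + η) ≤ ∑ v : Fin m → V, ∑ j, (∏ k, p (v k)) *
        (if G.Adj (v i) (v j) then (1 : ℝ) else 0) := by
      rw [sum_comm, ← add_sum_erase _ _ (mem_univ i)]
      have h₂ : ∑ v : Fin m → V, (∏ k, p (v k)) * (if G.Adj (v i) (v i) then (1 : ℝ) else 0)
          = 0 := by simp
      rw [h₂, zero_add, sum_congr rfl fun j hj ↦ hpair i j (ne_of_mem_erase hj).symm, sum_const,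
        card_erase_of_mem (mem_univ i), card_univ, Fintype.card_fin, nsmul_eq_mul,
        Nat.cast_sub (by lia), Nat.cast_one]
      exact mul_le_mul_of_nonneg_left hG (sub_nonneg.mpr (by exact_mod_cast (by lia : 1 ≤ m)))
    calc M * (c + η) = ∑ _i : Fin m, (m - 1) * (c + η) := by
          rw [sum_const, card_univ, Fintype.card_fin, nsmul_eq_mul, hMdef]
          ring
      _ ≤ _ := sum_le_sum fun i _ ↦ h₁ i
  have hupper : ∑ v : Fin m → V, (∏ k, p (v k)) *
      ∑ i, ∑ j, (if G.Adj (v i) (v j) then (1 : ℝ) else 0) ≤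
        c * M + M * (Fintype.card (α ↪ Fin m) * t) := by
    calc _ ≤ ∑ v : Fin m → V, (∏ k, p (v k)) * (c * M + M * ∑ ψ : α ↪ Fin m,
          (if ∀ a b, F.Adj a b → G.Adj ((v ∘ ψ) a) ((v ∘ ψ) b) then 1 else 0)) :=
        sum_le_sum fun v _ ↦
          mul_le_mul_of_nonneg_left (hpt v) (prod_nonneg fun _ _ ↦ hp0 _)
      _ = c * M + M * ∑ ψ : α ↪ Fin m, ∑ v : Fin m → V, (∏ k, p (v k)) *
          (if ∀ a b, F.Adj a b → G.Adj ((v ∘ ψ) a) ((v ∘ ψ) b) then 1 else 0) := by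
        simp_rw [mul_add, sum_add_distrib, ← sum_mul, htot, one_mul]
        rw [sum_comm, mul_sum]
        congr 1
        refine sum_congr rfl fun v _ ↦ ?_
        rw [← mul_sum]
        ring
      _ = _ := by
        congr 2
        rw [sum_congr rfl fun ψ _ ↦ sum_prod_mul_comp_embedding p hp ψ fun u ↦
          if ∀ a b, F.Adj a b → G.Adj (u a) (u b) then 1 else 0]
        rw [sum_const, card_univ, nsmul_eq_mul]
  refine le_of_mul_le_mul_left ?_ hM
  linarith

open scoped Classical in
/-- A graph of large spectral radius carries a well-spread probability vector of large weighted
edge density. -/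
theorem exists_weight_of_specRad_pos {V : Type*} [Fintype V] (G : SimpleGraph V)
    (hG : 0 < specRad G) :
    ∃ p : V → ℝ, (∀ x, 0 ≤ p x) ∧ ∑ x, p x = 1 ∧ (∀ x, p x ≤ 1 / specRad G) ∧
      specRad G / Fintype.card V ≤
        ∑ x, ∑ y, p x * p y * (if G.Adj x y then 1 else 0) := by
  have hmem : Module.End.HasEigenvalue (Matrix.toLin' (G.adjMatrix ℝ)) (specRad G) := by
    have hfin := Module.End.finite_hasEigenvalue (Matrix.toLin' (G.adjMatrix ℝ))
    have hne : {μ : ℝ | Module.End.HasEigenvalue (Matrix.toLin' (G.adjMatrix ℝ)) μ}.Nonempty := by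
      by_contra h
      rw [Set.not_nonempty_iff_eq_empty] at h
      have : specRad G = 0 := by
        rw [specRad]
        convert Real.sSup_empty
      exact hG.ne' this
    have := hne.csSup_mem hfin
    rw [specRad]
    convert this
  set μ := specRad G
  obtain ⟨z, hz⟩ := hmem.exists_hasEigenvector
  have hz' (x : V) : ∑ y, (if G.Adj x y then z y else 0) = μ * z x := by
    have := congrFun hz.apply_eq_smul x
    simpa [Matrix.toLin'_apply, Matrix.mulVec, dotProduct, SimpleGraph.adjMatrix_apply] using this
  have habs (x : V) : μ * |z x| ≤ ∑ y, |z y| * (if G.Adj x y then 1 else 0) := by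
    rw [← abs_of_pos hG, ← abs_mul, ← hz']
    refine (abs_sum_le_sum_abs _ _).trans (sum_le_sum fun y _ ↦ ?_)
    split_ifs <;> simp
  obtain ⟨x₀, hx₀⟩ : ∃ x, z x ≠ 0 := Function.ne_iff.mp hz.2
  set S := ∑ x, |z x| with hSdef
  have hS : 0 < S := sum_pos' (fun _ _ ↦ abs_nonneg _) ⟨x₀, mem_univ _, abs_pos.mpr hx₀⟩
  have hcard : (0 : ℝ) < Fintype.card V := by
    exact_mod_cast Fintype.card_pos_iff.mpr ⟨x₀⟩
  refine ⟨fun x ↦ |z x| / S, fun x ↦ by positivity, ?_, fun x ↦ ?_, ?_⟩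
  · rw [← sum_div, div_self hS.ne']
  · rw [div_le_div_iff₀ hS hG, one_mul, mul_comm]
    refine (habs x).trans (sum_le_sum fun y _ ↦ ?_)
    split_ifs <;> simp
  · have h₁ : ∑ x, ∑ y, |z x| / S * (|z y| / S) * (if G.Adj x y then (1 : ℝ) else 0) =
        (∑ x, |z x| * ∑ y, |z y| * (if G.Adj x y then 1 else 0)) / S ^ 2 := by
      simp_rw [mul_sum, sum_div]
      refine sum_congr rfl fun x _ ↦ sum_congr rfl fun y _ ↦ ?_
      ring
    have h₂ : μ * ∑ x, |z x| ^ 2 ≤ ∑ x, |z x| * ∑ y, |z y| * (if G.Adj x y then 1 else 0) := by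
      rw [mul_sum]
      refine sum_le_sum fun x _ ↦ ?_
      nlinarith [mul_le_mul_of_nonneg_left (habs x) (abs_nonneg (z x))]
    have h₃ : S ^ 2 ≤ Fintype.card V * ∑ x, |z x| ^ 2 := sq_sum_le_card_mul_sum_sq
    rw [h₁, div_le_div_iff₀ hcard (by positivity)]
    calc μ * S ^ 2 ≤ μ * (Fintype.card V * ∑ x, |z x| ^ 2) :=
          mul_le_mul_of_nonneg_left h₃ hG.le
      _ = (μ * ∑ x, |z x| ^ 2) * Fintype.card V := by ring
      _ ≤ _ := mul_le_mul_of_nonneg_right h₂ hcard.le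

open scoped Classical in
/-- Few maps fail to be injective. -/
theorem card_not_injective_mul_card_le {α V : Type*} [Fintype α] [Fintype V] :
    #{u : α → V | ¬ Function.Injective u} * Fintype.card V ≤
      Fintype.card α ^ 2 * Fintype.card V ^ Fintype.card α := by
  have hsub : ({u : α → V | ¬ Function.Injective u} : Finset (α → V)) ⊆
      (univ : Finset α).offDiag.biUnion fun ab ↦ {u : α → V | u ab.1 = u ab.2} := by
    intro u hu
    simp only [mem_filter, mem_univ, true_and, Function.Injective, not_forall] at hu
    obtain ⟨a, b, hab, hne⟩ := hu
    simp only [mem_biUnion, mem_offDiag, mem_univ, true_and, mem_filter, Prod.exists]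
    exact ⟨a, b, hne, hab⟩
  have hpair (ab : α × α) (hab : ab ∈ (univ : Finset α).offDiag) :
      #{u : α → V | u ab.1 = u ab.2} * Fintype.card V ≤ Fintype.card V ^ Fintype.card α := by
    obtain ⟨a, b⟩ := ab
    simp only [mem_offDiag, mem_univ, true_and] at hab
    rw [← Fintype.card_fun, ← card_univ (α := V), ← card_product, ← card_univ (α := α → V)]
    refine card_le_card_of_injOn (fun ux ↦ Function.update ux.1 a ux.2) (by simp) ?_
    rintro ⟨u, x⟩ hu ⟨w, y⟩ hw huw
    simp only [coe_product, coe_filter, mem_univ, true_and, coe_univ, Set.mem_prod,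
      Set.mem_ofPred_eq, Set.mem_univ, and_true] at hu hw
    have hne {k : α} (hk : k ≠ a) : u k = w k := by
      simpa [hk] using congrFun huw k
    have hxy : x = y := by simpa using congrFun huw a
    refine Prod.ext (funext fun k ↦ ?_) hxy
    rcases eq_or_ne k a with rfl | hk
    · exact hu.trans ((hne hab.symm).trans hw.symm)
    · exact hne hk
  calc _ ≤ (∑ ab ∈ (univ : Finset α).offDiag, #{u : α → V | u ab.1 = u ab.2}) *
        Fintype.card V := Nat.mul_le_mul_right _ ((card_le_card hsub).trans card_biUnion_le)
    _ ≤ #(univ : Finset α).offDiag * Fintype.card V ^ Fintype.card α := by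
      rw [sum_mul]
      exact (sum_le_card_nsmul _ _ _ hpair).trans_eq (smul_eq_mul _ _)
    _ ≤ _ := by
      refine Nat.mul_le_mul_right _ ?_
      rw [offDiag_card, card_univ, sq]
      exact Nat.sub_le _ _

open scoped Classical in
/-- Every homomorphism is an injective homomorphism or a non-injective map. -/
theorem card_hom_le_card_injective_hom_add {α V : Type*} [Fintype α] [Fintype V]
    (F : SimpleGraph α) (G : SimpleGraph V) :
    #{u : α → V | ∀ a b, F.Adj a b → G.Adj (u a) (u b)} ≤
      Nat.card {φ : F →g G // Function.Injective φ} +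
        #{u : α → V | ¬ Function.Injective u} := by
  rw [← card_filter_add_card_filter_not Function.Injective, filter_filter, filter_filter]
  refine add_le_add (le_of_eq ?_) (card_le_card fun u hu ↦ ?_)
  · rw [← Fintype.card_subtype, ← Nat.card_eq_fintype_card]
    exact Nat.card_congr
      ⟨fun u ↦ ⟨⟨u.1, fun {a b} h ↦ u.2.1 a b h⟩, u.2.2⟩,
        fun φ ↦ ⟨φ.1, fun a b h ↦ φ.1.map_adj h, φ.2⟩, fun _ ↦ rfl, fun _ ↦ rfl⟩
  · simp only [mem_filter, mem_univ, true_and] at hu ⊢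
    exact hu.2

/-- **Spectral supersaturation (Erdős–Stone–Bollobás type).** Let `F` be a graph with
chromatic number `r + 1` (`r ≥ 1`) on `f` vertices. For every `ε > 0` there are
`δ > 0` and `n₀` such that every graph `G` on `n ≥ n₀` vertices with
`λ(G) ≥ (1 − 1/r + ε)·n` contains at least `δ·n^f` copies of `F` (counted as injective
graph homomorphisms from `F` into `G`). -/
theorem spectral_supersaturation {α : Type} [Fintype α] (F : SimpleGraph α)
    (r : ℕ) (hr : 1 ≤ r) (hχ : F.chromaticNumber = (r + 1 : ℕ)) :
    ∀ ε : ℝ, 0 < ε → ∃ δ : ℝ, 0 < δ ∧ ∃ n₀ : ℕ, ∀ n : ℕ, n₀ ≤ n →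
      ∀ G : SimpleGraph (Fin n), (1 - 1 / (r : ℝ) + ε) * n ≤ specRad G →
        δ * (n : ℝ) ^ (Fintype.card α) ≤
          (Nat.card {φ : F →g G // Function.Injective φ} : ℝ) := by
  classical
  intro ε hε
  have hr' : (1 : ℝ) / r ≤ 1 := by
    rw [div_le_one (by positivity)]
    exact_mod_cast hr
  have hF : F.Colorable (r + 1) := SimpleGraph.chromaticNumber_le_iff_colorable.mp hχ.le
  obtain ⟨m, hm, hfree⟩ := exists_two_mul_card_edgeFinset_le_of_free hr hF (half_pos hε)
  set f := Fintype.card α with hf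
  set N : ℝ := Fintype.card (α ↪ Fin m) + 1 with hN
  have hN0 : 0 < N := by positivity
  set δ : ℝ := ε / 2 / N * ε ^ f with hδ
  have hδ0 : 0 < δ := by positivity
  obtain ⟨n₀, hn₀⟩ := exists_nat_ge ((f : ℝ) ^ 2 * 2 / δ)
  refine ⟨δ / 2, half_pos hδ0, n₀ + 1, fun n hn G hG ↦ ?_⟩
  have hn0 : (0 : ℝ) < n := by exact_mod_cast (by lia : 0 < n)
  have hεn : ε * n ≤ specRad G :=
    le_trans (mul_le_mul_of_nonneg_right (by linarith) hn0.le) hG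
  have hpos : 0 < specRad G := lt_of_lt_of_le (by positivity) hεn
  obtain ⟨p, hp0, hp1, hpb, hpd⟩ := exists_weight_of_specRad_pos G hpos
  have hdens : 1 - 1 / (r : ℝ) + ε / 2 + ε / 2 ≤
      ∑ x, ∑ y, p x * p y * (if G.Adj x y then 1 else 0) := by
    refine le_trans ?_ hpd
    rw [Fintype.card_fin, le_div_iff₀ hn0]
    linarith
  have hmain := le_card_embedding_mul_weighted_hom_density F G hp0 hp1 (by linarith) hm
    hfree hdens
  set H : ℕ := #{u : α → Fin n | ∀ a b, F.Adj a b → G.Adj (u a) (u b)} with hH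
  set t : ℝ := ∑ u : α → Fin n, (∏ a, p (u a)) *
    (if ∀ a b, F.Adj a b → G.Adj (u a) (u b) then 1 else 0) with ht
  have htH : t * (ε * n) ^ f ≤ H := by
    rw [ht, sum_mul, hH, ← sum_boole]
    refine sum_le_sum fun u _ ↦ ?_
    have h₁ : ∏ a, p (u a) ≤ ∏ _a : α, 1 / (ε * n) :=
      prod_le_prod (fun _ _ ↦ hp0 _) fun a _ ↦
        (hpb _).trans (one_div_le_one_div_of_le (by positivity) hεn)
    rw [prod_const, card_univ, ← hf, div_pow, one_pow, le_div_iff₀ (by positivity)] at h₁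
    split_ifs
    · simpa using h₁
    · simp
  have ht0 : 0 ≤ t := sum_nonneg fun u _ ↦
    mul_nonneg (prod_nonneg fun _ _ ↦ hp0 _) (by split_ifs <;> norm_num)
  have htN : ε / 2 / N ≤ t := by
    rw [div_le_iff₀ hN0, hN]
    linarith
  have hδH : δ * (n : ℝ) ^ f ≤ H := by
    refine le_trans ?_ htH
    rw [mul_pow, ← mul_assoc, hδ]
    gcongr
  obtain ⟨B, hsplit, hinj⟩ : ∃ B : ℕ,
      H ≤ Nat.card {φ : F →g G // Function.Injective φ} + B ∧ B * n ≤ f ^ 2 * n ^ f := by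
    refine ⟨_, ?_, by simpa only [Fintype.card_fin] using
      card_not_injective_mul_card_le (α := α) (V := Fin n)⟩
    convert card_hom_le_card_injective_hom_add F G
  have hsplit' : (H : ℝ) ≤ Nat.card {φ : F →g G // Function.Injective φ} + B := by
    exact_mod_cast hsplit
  have hinj' : (B : ℝ) * n ≤ (f : ℝ) ^ 2 * (n : ℝ) ^ f := by exact_mod_cast hinj
  have hnδ : (f : ℝ) ^ 2 ≤ δ / 2 * n := by
    rw [div_le_iff₀ hδ0] at hn₀
    have : (n₀ : ℝ) ≤ n := by exact_mod_cast (by lia : n₀ ≤ n)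
    nlinarith
  have hB : (B : ℝ) ≤ δ / 2 * (n : ℝ) ^ f := by
    refine le_of_mul_le_mul_right (hinj'.trans ?_) hn0
    calc (f : ℝ) ^ 2 * (n : ℝ) ^ f ≤ δ / 2 * n * (n : ℝ) ^ f := by gcongr
      _ = _ := by ring
  linarith
end

section
/- Let G be a simple graph with m ≥ 4 edges. Then the signless Laplacian spectral radius satisfies q(G) ≤ m + 1, with equality if and only if G is a star K_{1,m} together with possibly some isolated vertices. -/
open Matrix

/-- The signless Laplacian spectral radius of a finite simple graph: the largest
eigenvalue of `Q(G) = D(G) + A(G)`, expressed as the supremum of the set of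
eigenvalues of the associated linear endomorphism. -/
noncomputable def signlessLapRad {V : Type*} [Fintype V] (G : SimpleGraph V) : ℝ :=
  letI := Classical.decEq V
  letI := Classical.decRel G.Adj
  sSup {μ : ℝ | Module.End.HasEigenvalue
    (Matrix.toLin' (Matrix.diagonal (fun v => (G.degree v : ℝ)) + SimpleGraph.adjMatrix ℝ G)) μ}

namespace SimpleGraph

variable {V : Type*} [Fintype V] [DecidableEq V] (G : SimpleGraph V) [DecidableRel G.Adj]

/-- The signless Laplacian matrix `D + A`. -/
abbrev signlessLapMatrix : Matrix V V ℝ :=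
  Matrix.diagonal (fun v => (G.degree v : ℝ)) + G.adjMatrix ℝ

theorem signlessLapRad_eq_sSup :
    signlessLapRad G =
      sSup {μ : ℝ | Module.End.HasEigenvalue (Matrix.toLin' G.signlessLapMatrix) μ} := by
  unfold signlessLapRad signlessLapMatrix
  congr!

theorem signlessLapMatrix_mulVec_apply (x : V → ℝ) (v : V) :
    (G.signlessLapMatrix *ᵥ x) v = ∑ w ∈ G.neighborFinset v, (x v + x w) := by
  rw [Matrix.add_mulVec, Pi.add_apply, Matrix.mulVec_diagonal, adjMatrix_mulVec_apply,
    Finset.sum_add_distrib, Finset.sum_const, card_neighborFinset_eq_degree, nsmul_eq_mul]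

theorem hasEigenvalue_signlessLapMatrix_iff (μ : ℝ) :
    Module.End.HasEigenvalue (Matrix.toLin' G.signlessLapMatrix) μ ↔
      ∃ x : V → ℝ, x ≠ 0 ∧ ∀ v, ∑ w ∈ G.neighborFinset v, (x v + x w) = μ * x v := by
  constructor
  · intro h
    obtain ⟨x, hx⟩ := h.exists_hasEigenvector
    refine ⟨x, hx.2, fun v => ?_⟩
    rw [← signlessLapMatrix_mulVec_apply]
    exact congrFun hx.apply_eq_smul v
  · rintro ⟨x, hx0, hx⟩
    refine Module.End.hasEigenvalue_of_hasEigenvector (x := x)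
      ⟨Module.End.mem_eigenspace_iff.2 ?_, hx0⟩
    ext v
    rw [Matrix.toLin'_apply, signlessLapMatrix_mulVec_apply, hx v]
    rfl

variable {G}

theorem card_incidenceFinset_union_of_adj {u v : V} (h : G.Adj u v) :
    (G.incidenceFinset u ∪ G.incidenceFinset v).card + 1 = G.degree u + G.degree v := by
  have hi : G.incidenceFinset u ∩ G.incidenceFinset v = {s(u, v)} := by
    ext e
    simpa using Set.ext_iff.1 (G.incidenceSet_inter_incidenceSet_of_adj h) e
  rw [← card_incidenceFinset_eq_degree, ← card_incidenceFinset_eq_degree,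
    ← Finset.card_union_add_card_inter (G.incidenceFinset u), hi, Finset.card_singleton]

theorem degree_add_degree_le_of_adj {u v : V} (h : G.Adj u v) :
    G.degree u + G.degree v ≤ G.edgeFinset.card + 1 := by
  rw [← card_incidenceFinset_union_of_adj h]
  gcongr
  exact Finset.union_subset (G.incidenceFinset_subset u) (G.incidenceFinset_subset v)

theorem edge_meets_of_degree_add_degree_eq {u v : V} (h : G.Adj u v)
    (heq : G.degree u + G.degree v = G.edgeFinset.card + 1) {a b : V} (hab : G.Adj a b) :
    (a = u ∨ b = u) ∨ a = v ∨ b = v := by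
  have hU : G.incidenceFinset u ∪ G.incidenceFinset v = G.edgeFinset := by
    refine Finset.eq_of_subset_of_card_le
      (Finset.union_subset (G.incidenceFinset_subset u) (G.incidenceFinset_subset v)) ?_
    have := card_incidenceFinset_union_of_adj h
    omega
  have hmem : s(a, b) ∈ G.edgeFinset := by simpa using hab
  rw [← hU] at hmem
  simp only [Finset.mem_union, mem_incidenceFinset, mk'_mem_incidenceSet_iff] at hmem
  grind

/-- Pairwise intersecting edges, at least four in number, share a common vertex. -/
theorem exists_common_vertex_of_pairwise_meet (hm : 4 ≤ G.edgeFinset.card)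
    (h : ∀ u v a b, G.Adj u v → G.Adj a b → (a = u ∨ b = u) ∨ a = v ∨ b = v) :
    ∃ c, ∀ a b, G.Adj a b → a = c ∨ b = c := by
  by_contra! hc
  obtain ⟨e, he⟩ : G.edgeFinset.Nonempty := Finset.card_pos.1 (by omega)
  induction e with | _ u v
  have huv : G.Adj u v := by simpa using he
  obtain ⟨a, ha, hva⟩ : ∃ a, a ≠ u ∧ G.Adj v a := by
    obtain ⟨a, b, hab, h1, h2⟩ := hc u
    rcases h u v a b huv hab with (h3 | h3) | rfl | rfl
    · exact absurd h3 h1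
    · exact absurd h3 h2
    · exact ⟨b, h2, hab⟩
    · exact ⟨a, h1, hab.symm⟩
  have hua : G.Adj u a := by
    obtain ⟨b, c, hbc, h1, h2⟩ := hc v
    have h3 := h u v b c huv hbc
    have h4 := h v a b c hva hbc
    have := hbc.symm
    grind
  have hlt : ({s(u, v), s(v, a), s(u, a)} : Finset (Sym2 V)).card < G.edgeFinset.card :=
    Finset.card_le_three.trans_lt hm
  obtain ⟨f, hf, hnot⟩ := Finset.exists_mem_notMem_of_card_lt_card hlt
  induction f with | _ b c
  have hbc : G.Adj b c := by simpa using hf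
  have h1 := h u v b c huv hbc
  have h2 := h v a b c hva hbc
  have h3 := h u a b c hua hbc
  have := hbc.ne
  have := hva.ne
  have := huv.ne
  simp only [Finset.mem_insert, Finset.mem_singleton, Sym2.eq_iff] at hnot
  grind

omit [DecidableEq V] in
theorem exists_adj_max_abs_add {x : V → ℝ} {μ : ℝ} (hμ : 0 < μ) (hx0 : x ≠ 0)
    (hx : ∀ v, ∑ w ∈ G.neighborFinset v, (x v + x w) = μ * x v) :
    ∃ u v, G.Adj u v ∧ 0 < |x u + x v| ∧ ∀ a b, G.Adj a b → |x a + x b| ≤ |x u + x v| := by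
  obtain ⟨p, hp⟩ := Function.ne_iff.1 hx0
  have hsum : ∑ w ∈ G.neighborFinset p, (x p + x w) ≠ 0 := by
    rw [hx p]
    exact mul_ne_zero hμ.ne' hp
  obtain ⟨q, hq, hpq⟩ := Finset.exists_ne_zero_of_sum_ne_zero hsum
  rw [mem_neighborFinset] at hq
  obtain ⟨⟨u, v⟩, huv, hmax⟩ := Finset.exists_max_image
    (Finset.univ.filter fun e : V × V => G.Adj e.1 e.2) (fun e => |x e.1 + x e.2|)
    ⟨(p, q), by simpa using hq⟩
  have hmax' : ∀ a b, G.Adj a b → |x a + x b| ≤ |x u + x v| :=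
    fun a b hab => hmax (a, b) (by simpa using hab)
  exact ⟨u, v, by simpa using huv, (abs_pos.2 hpq).trans_le (hmax' p q hq), hmax'⟩

omit [DecidableEq V] in
theorem sum_abs_add_le_degree_mul {x : V → ℝ} {M : ℝ}
    (hM : ∀ a b, G.Adj a b → |x a + x b| ≤ M) (v : V) :
    ∑ w ∈ G.neighborFinset v, |x v + x w| ≤ G.degree v * M := by
  rw [← card_neighborFinset_eq_degree, ← nsmul_eq_mul]
  exact Finset.sum_le_card_nsmul _ _ _ fun w hw => hM v w (by simpa using hw)

omit [DecidableEq V] in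
theorem mul_abs_add_le_sum {x : V → ℝ} {μ : ℝ}
    (hx : ∀ v, ∑ w ∈ G.neighborFinset v, (x v + x w) = μ * x v) (u v : V) :
    μ * |x u + x v| ≤
      ∑ w ∈ G.neighborFinset u, |x u + x w| + ∑ w ∈ G.neighborFinset v, |x v + x w| :=
  calc μ * |x u + x v| ≤ |μ * (x u + x v)| := by
        rw [abs_mul]
        gcongr
        exact le_abs_self μ
    _ = |∑ w ∈ G.neighborFinset u, (x u + x w) + ∑ w ∈ G.neighborFinset v, (x v + x w)| := by
        rw [hx, hx, mul_add]
    _ ≤ _ := (abs_add_le _ _).trans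
        (add_le_add (Finset.abs_sum_le_sum_abs _ _) (Finset.abs_sum_le_sum_abs _ _))

omit [DecidableEq V] in
theorem le_degree_add_degree_of_abs_add_max {x : V → ℝ} {μ : ℝ}
    (hx : ∀ v, ∑ w ∈ G.neighborFinset v, (x v + x w) = μ * x v) {u v : V}
    (hpos : 0 < |x u + x v|) (hmax : ∀ a b, G.Adj a b → |x a + x b| ≤ |x u + x v|) :
    μ ≤ G.degree u + G.degree v := by
  refine le_of_mul_le_mul_right ?_ hpos
  have := mul_abs_add_le_sum hx u v
  have := sum_abs_add_le_degree_mul hmax u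
  have := sum_abs_add_le_degree_mul hmax v
  linarith

omit [DecidableEq V] in
theorem abs_add_eq_of_degree_add_degree_le {x : V → ℝ} {μ : ℝ}
    (hx : ∀ v, ∑ w ∈ G.neighborFinset v, (x v + x w) = μ * x v) {u v : V}
    (hmax : ∀ a b, G.Adj a b → |x a + x b| ≤ |x u + x v|)
    (hμ : (G.degree u + G.degree v : ℝ) ≤ μ) {w : V} (huw : G.Adj u w) :
    |x u + x w| = |x u + x v| := by
  refine (hmax u w huw).eq_of_not_lt fun hlt => ?_
  have hu : ∑ w ∈ G.neighborFinset u, |x u + x w| < G.degree u * |x u + x v| := by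
    rw [← card_neighborFinset_eq_degree, ← nsmul_eq_mul, ← Finset.sum_const]
    exact Finset.sum_lt_sum (fun b hb => hmax u b (by simpa using hb))
      ⟨w, by simpa using huw, hlt⟩
  have := mul_abs_add_le_sum hx u v
  have := sum_abs_add_le_degree_mul hmax v
  have := mul_le_mul_of_nonneg_right hμ (abs_nonneg (x u + x v))
  linarith

theorem le_card_edgeFinset_add_one_of_hasEigenvalue {μ : ℝ}
    (h : Module.End.HasEigenvalue (Matrix.toLin' G.signlessLapMatrix) μ) :
    μ ≤ G.edgeFinset.card + 1 := by
  obtain ⟨x, hx0, hx⟩ := (G.hasEigenvalue_signlessLapMatrix_iff μ).1 h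
  rcases le_or_gt μ 0 with hμ | hμ
  · exact hμ.trans (by positivity)
  obtain ⟨u, v, huv, hpos, hmax⟩ := exists_adj_max_abs_add hμ hx0 hx
  exact (le_degree_add_degree_of_abs_add_max hx hpos hmax).trans
    (mod_cast degree_add_degree_le_of_adj huv)

theorem exists_common_vertex_of_hasEigenvalue (hm : 4 ≤ G.edgeFinset.card)
    (h : Module.End.HasEigenvalue (Matrix.toLin' G.signlessLapMatrix)
      (G.edgeFinset.card + 1 : ℝ)) :
    ∃ c, ∀ a b, G.Adj a b → a = c ∨ b = c := by
  obtain ⟨x, hx0, hx⟩ := (G.hasEigenvalue_signlessLapMatrix_iff _).1 h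
  obtain ⟨u, v, huv, hpos, hmax⟩ := exists_adj_max_abs_add (by positivity) hx0 hx
  have hdeg : ∀ a b, G.Adj a b → |x a + x b| = |x u + x v| →
      G.degree a + G.degree b = G.edgeFinset.card + 1 := fun a b hab heq =>
    (degree_add_degree_le_of_adj hab).antisymm <| by
      exact_mod_cast le_degree_add_degree_of_abs_add_max hx (heq ▸ hpos) (heq ▸ hmax)
  have huv_deg := hdeg u v huv rfl
  have hu : ∀ w, G.Adj u w → |x u + x w| = |x u + x v| := fun w =>
    abs_add_eq_of_degree_add_degree_le hx hmax (mod_cast huv_deg.le)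
  have hv : ∀ w, G.Adj v w → |x v + x w| = |x u + x v| := fun w hw => by
    rw [add_comm (x u)] at hmax ⊢
    exact abs_add_eq_of_degree_add_degree_le hx hmax
      (by rw [add_comm]; exact_mod_cast huv_deg.le) hw
  refine exists_common_vertex_of_pairwise_meet hm fun a b c d hab hcd =>
    edge_meets_of_degree_add_degree_eq hab (hdeg a b hab ?_) hcd
  rcases edge_meets_of_degree_add_degree_eq huv huv_deg hab with (rfl | rfl) | rfl | rfl
  · exact hu b hab
  · rw [add_comm (x a)]
    exact hu a hab.symm
  · exact hv b hab
  · rw [add_comm (x a)]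
    exact hv a hab.symm

theorem hasEigenvalue_signlessLapMatrix_of_common_vertex (hm : G.edgeFinset.card ≠ 0) {c : V}
    (hc : ∀ a b, G.Adj a b → a = c ∨ b = c) :
    Module.End.HasEigenvalue (Matrix.toLin' G.signlessLapMatrix)
      (G.edgeFinset.card + 1 : ℝ) := by
  have hdeg : G.degree c = G.edgeFinset.card := by
    rw [← card_incidenceFinset_eq_degree]
    congr 1
    refine (G.incidenceFinset_subset c).antisymm fun e he => ?_
    induction e with | _ a b
    have hab : G.Adj a b := by simpa using he
    rw [mem_incidenceFinset, mk'_mem_incidenceSet_iff]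
    exact ⟨hab, (hc a b hab).imp Eq.symm Eq.symm⟩
  refine (G.hasEigenvalue_signlessLapMatrix_iff _).2
    ⟨fun v => if v = c then G.edgeFinset.card else if G.Adj c v then 1 else 0, ?_, fun v => ?_⟩
  · exact Function.ne_iff.2 ⟨c, by simpa using hm⟩
  by_cases hv : v = c
  · subst hv
    have : ∀ w ∈ G.neighborFinset v, ((if v = v then (G.edgeFinset.card : ℝ) else
        if G.Adj v v then 1 else 0) + if w = v then (G.edgeFinset.card : ℝ) else
        if G.Adj v w then 1 else 0) = G.edgeFinset.card + 1 := fun w hw => by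
      rw [mem_neighborFinset] at hw
      simp [hw, hw.ne']
    rw [Finset.sum_congr rfl this, Finset.sum_const, card_neighborFinset_eq_degree, hdeg]
    simp
    ring
  by_cases hcv : G.Adj c v
  · have hN : G.neighborFinset v = {c} := by
      ext w
      rw [mem_neighborFinset, Finset.mem_singleton]
      exact ⟨fun hw => (hc v w hw).resolve_left hv, fun hw => hw ▸ hcv.symm⟩
    simp [hN, hv, hcv, add_comm]
  · have hN : G.neighborFinset v = ∅ := by
      refine Finset.eq_empty_of_forall_notMem fun w hw => ?_
      rw [mem_neighborFinset] at hw
      exact hcv ((hc v w hw).resolve_left hv ▸ hw.symm)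
    simp [hN, hv, hcv]

end SimpleGraph

/-- If `G` has `m ≥ 4` edges, then `q(G) ≤ m + 1`, with equality iff `G` is the star
`K_{1,m}` together with possibly some isolated vertices (i.e. all edges of `G` share a
common vertex). -/
theorem signlessLap_le_edges_add_one {V : Type*} [Fintype V] [DecidableEq V]
    (G : SimpleGraph V) [DecidableRel G.Adj] (hm : 4 ≤ G.edgeFinset.card) :
    signlessLapRad G ≤ (G.edgeFinset.card : ℝ) + 1 ∧
      (signlessLapRad G = (G.edgeFinset.card : ℝ) + 1 ↔
        ∃ c : V, ∀ a b : V, G.Adj a b → a = c ∨ b = c) := by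
  have hle : ∀ μ ∈ {μ : ℝ | Module.End.HasEigenvalue (Matrix.toLin' G.signlessLapMatrix) μ},
      μ ≤ G.edgeFinset.card + 1 :=
    fun μ hμ => SimpleGraph.le_card_edgeFinset_add_one_of_hasEigenvalue hμ
  rw [G.signlessLapRad_eq_sSup]
  refine ⟨Real.sSup_le hle (by positivity), fun heq => ?_, fun ⟨c, hc⟩ => ?_⟩
  · have hne : {μ : ℝ | Module.End.HasEigenvalue
        (Matrix.toLin' G.signlessLapMatrix) μ}.Nonempty := by
      rw [Set.nonempty_iff_ne_empty]
      intro hempty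
      rw [hempty, Real.sSup_empty] at heq
      exact (by positivity : (0 : ℝ) ≠ G.edgeFinset.card + 1) heq
    have hmem := hne.csSup_mem (Module.End.finite_hasEigenvalue _)
    rw [heq] at hmem
    exact SimpleGraph.exists_common_vertex_of_hasEigenvalue hm hmem
  · exact IsGreatest.csSup_eq
      ⟨SimpleGraph.hasEigenvalue_signlessLapMatrix_of_common_vertex (by omega) hc, hle⟩
end
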